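/- arXiv:2605.17271 — 2 statements merged into one kernel-verified Lean document; each statement's English description precedes it below -/
import Mathlib

section
/- Dynamic programming principle, value representation: the bi-causal optimal transport value satisfies W_bc(μ,μ') = inf_{π₀ ∈ Π(μ₀,μ₀')} E_{π₀}[V_0(Y_0,Y_0')] = inf_{π ∈ M_bc(μ,μ')} E_π[Σ_{n=0}^N c_n(Y_n, Y'_n)]; in particular the infimum over all bi-causal couplings equals the infimum over Markov bi-causal couplings. -/
open MeasureTheory ProbabilityTheory
open scoped ProbabilityTheory ENNReal

noncomputable section

/-- The state space `S = ℝ^d`. -/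
abbrev Stt (d : ℕ) := Fin d → ℝ

/-- The path space `𝒴 = S^{N+1}`. -/
abbrev Pth (d N : ℕ) := Fin (N + 1) → Stt d

/-- The finite-horizon Markov measure on paths built from an initial law `π₀` and one-step
transition kernels `Q`, where `Q n` is the kernel for the transition into time `n`. -/
noncomputable def pathMeasure {E : Type*} [MeasurableSpace E]
    (π₀ : Measure E) (Q : ℕ → Kernel E E) : (n : ℕ) → Measure (Fin (n + 1) → E)
  | 0 => π₀.map (fun x => fun _ => x)
  | n + 1 => (pathMeasure π₀ Q n).bind
      (fun h => ((Q (n + 1)) (h (Fin.last n))).map (Fin.snoc h))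

/-- `Π_M(T, T')`: one-step coupling kernels with prescribed marginal transitions. -/
def PiM {S : Type*} [MeasurableSpace S] (T T' : Kernel S S) :
    Set (Kernel (S × S) (S × S)) :=
  {Q | IsMarkovKernel Q ∧
    ∀ y y' : S, (Q (y, y')).map Prod.fst = T y ∧ (Q (y, y')).map Prod.snd = T' y'}

/-- Split a path of pairs into a pair of paths. -/
def splitPath {S : Type*} {n : ℕ} (h : Fin n → S × S) : (Fin n → S) × (Fin n → S) :=
  (fun i => (h i).1, fun i => (h i).2)

/-- `M_bc(μ,μ')`: the Markov bi-causal couplings `π_{π₀,𝐐}` with `π₀ ∈ Π(μ₀,μ₀')` and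
`Q_n ∈ Π_M(T_n, T'_n)` for `n = 1,…,N`. -/
def Mbc {d : ℕ} (N : ℕ) (μ₀ μ₀' : Measure (Stt d)) (T T' : ℕ → Kernel (Stt d) (Stt d)) :
    Set (Measure (Pth d N × Pth d N)) :=
  {π | ∃ (π₀ : Measure (Stt d × Stt d)) (Q : ℕ → Kernel (Stt d × Stt d) (Stt d × Stt d)),
    IsProbabilityMeasure π₀ ∧
    π₀.map Prod.fst = μ₀ ∧ π₀.map Prod.snd = μ₀' ∧
    (∀ n, 1 ≤ n → n ≤ N → Q n ∈ PiM (T n) (T' n)) ∧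
    π = (pathMeasure π₀ Q N).map splitPath}

/-- The joint prefix `(𝐲_{0:n-1}, 𝐲'_{0:n-1})` of a pair of paths. -/
def prefixPair {d N : ℕ} (n : ℕ) (hn : n ≤ N + 1) (ω : Pth d N × Pth d N) :
    (Fin n → Stt d) × (Fin n → Stt d) :=
  (fun i => ω.1 (Fin.castLE hn i), fun i => ω.2 (Fin.castLE hn i))

/-- `π ∈ Π_bc(μ,μ')`: `π` is a coupling of `(μ,μ')` whose one-step conditional marginals
given the joint past are the prescribed transitions `T_n, T'_n`. -/
def IsBicausal {d N : ℕ} (μ μ' : Measure (Pth d N))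
    (T T' : ℕ → Kernel (Stt d) (Stt d)) (π : Measure (Pth d N × Pth d N)) : Prop :=
  π.map Prod.fst = μ ∧ π.map Prod.snd = μ' ∧
  ∀ n, ∀ _ : 1 ≤ n, ∀ hn : n ≤ N,
    (π.map (fun ω => (prefixPair n (by omega) ω, ω.1 ⟨n, by omega⟩))
        = (π.map (prefixPair n (by omega)))
            ⊗ₘ ((T n).comap (fun x : (Fin n → Stt d) × (Fin n → Stt d) =>
                  x.1 ⟨n - 1, by omega⟩) (by fun_prop))) ∧
    (π.map (fun ω => (prefixPair n (by omega) ω, ω.2 ⟨n, by omega⟩))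
        = (π.map (prefixPair n (by omega)))
            ⊗ₘ ((T' n).comap (fun x : (Fin n → Stt d) × (Fin n → Stt d) =>
                  x.2 ⟨n - 1, by omega⟩) (by fun_prop)))

/-- The objective `J_n` computed by backward recursion (`m = N - n` remaining steps):
`J_N = c_N` and `J_n = c_n + Q_{n+1}[J_{n+1}]`. -/
noncomputable def Jback {E : Type*} [MeasurableSpace E]
    (c : ℕ → E → ℝ≥0∞) (Q : ℕ → Kernel E E) (N : ℕ) : ℕ → E → ℝ≥0∞
  | 0 => c N
  | m + 1 => fun p =>
      c (N - (m + 1)) p + ∫⁻ z, Jback c Q N m z ∂((Q (N - m)) p)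

/-- The admissible families of one-step coupling kernels. -/
def admissible {d : ℕ} (T T' : ℕ → Kernel (Stt d) (Stt d)) (N : ℕ) :
    Set (ℕ → Kernel (Stt d × Stt d) (Stt d × Stt d)) :=
  {Q | ∀ n, 1 ≤ n → n ≤ N → Q n ∈ PiM (T n) (T' n)}

/-- The value function `V_n` of the bi-causal optimal transport problem. -/
noncomputable def Vval {d : ℕ} (c : ℕ → Stt d × Stt d → ℝ≥0∞)
    (T T' : ℕ → Kernel (Stt d) (Stt d)) (N n : ℕ) (p : Stt d × Stt d) : ℝ≥0∞ :=
  ⨅ Q ∈ admissible T T' N, Jback c Q N (N - n) p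

/-- The expected cumulative cost `E_π[Σ_{n=0}^N c_n(Y_n, Y'_n)]` of a coupling of paths. -/
noncomputable def totalCost {d N : ℕ} (c : ℕ → Stt d × Stt d → ℝ≥0∞)
    (π : Measure (Pth d N × Pth d N)) : ℝ≥0∞ :=
  ∫⁻ ω, ∑ i : Fin (N + 1), c i (ω.1 i, ω.2 i) ∂π


/-- inner approximation of continuous images of Baire space by images of compact sets. -/
lemma exists_compact_image {P : Type*} [TopologicalSpace P] [PolishSpace P]
    [MeasurableSpace P] [BorelSpace P] (μ : Measure P) [IsFiniteMeasure μ]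
    (f : (ℕ → ℕ) → P) (hf : Continuous f) (r : ℝ≥0∞) (hr : r < μ (Set.range f)) :
    ∃ K : Set (ℕ → ℕ), IsCompact K ∧ r ≤ μ (f '' K) := by
  letI := TopologicalSpace.upgradeIsCompletelyMetrizable P
  have step : ∀ (i : ℕ) (A : Set (ℕ → ℕ)), ∃ k : ℕ, r < μ (f '' A) →
      r < μ (f '' (A ∩ {x | x i ≤ k})) := by
    intro i A
    by_cases h : r < μ (f '' A)
    · have hU : f '' A = ⋃ k : ℕ, f '' (A ∩ {x | x i ≤ k}) := by
        rw [← Set.image_iUnion, ← Set.inter_iUnion]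
        congr 1
        ext x
        simp only [Set.mem_inter_iff, Set.mem_iUnion, Set.mem_setOf_eq]
        exact ⟨fun h => ⟨h, x i, le_rfl⟩, fun h => h.1⟩
      have hmono : Monotone fun k : ℕ => f '' (A ∩ {x | x i ≤ k}) := by
        intro a b hab
        apply Set.image_mono
        exact Set.inter_subset_inter_right _ (fun x (hx : x i ≤ a) => hx.trans hab)
      rw [hU, hmono.measure_iUnion] at h
      obtain ⟨k, hk⟩ := lt_iSup_iff.1 h
      exact ⟨k, fun _ => hk⟩
    · exact ⟨0, fun h' => absurd h' h⟩
  choose k hk using step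
  let A : ℕ → Set (ℕ → ℕ) := fun n =>
    Nat.rec Set.univ (fun i A => A ∩ {x | x i ≤ k i A}) n
  have hA1 : ∀ i, A (i + 1) = A i ∩ {x | x i ≤ k i (A i)} := fun i => rfl
  have hA : ∀ i, r < μ (f '' (A i)) := by
    intro i
    induction i with
    | zero => simpa [A] using hr
    | succ i ih => rw [hA1]; exact hk i _ ih
  have hAeq : ∀ i, A i = {x | ∀ j < i, x j ≤ k j (A j)} := by
    intro i
    induction i with
    | zero => ext x; simp [A]
    | succ i ih =>
      rw [hA1]
      ext x
      constructor
      · rintro ⟨h1, h2⟩ j hj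
        rw [ih] at h1
        rcases Nat.lt_succ_iff_lt_or_eq.1 hj with h | h
        · exact h1 j h
        · subst h; exact h2
      · intro h
        refine ⟨?_, h i (Nat.lt_succ_self i)⟩
        rw [ih]
        exact fun j hj => h j (Nat.lt_succ_of_lt hj)
  let K : Set (ℕ → ℕ) := Set.pi Set.univ (fun j => Set.Iic (k j (A j)))
  have hK : IsCompact K := isCompact_univ_pi (fun j => (Set.finite_Iic _).isCompact)
  refine ⟨K, hK, ?_⟩
  have hsub : (⋂ i, closure (f '' (A i))) ⊆ f '' K := by
    intro p hp
    have : ∀ i : ℕ, ∃ y ∈ A i, dist p (f y) < 1 / ((i : ℝ) + 1) := by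
      intro i
      have := Metric.mem_closure_iff.1 (Set.mem_iInter.1 hp i) (1 / ((i : ℝ) + 1)) (by positivity)
      obtain ⟨_, ⟨y, hy, rfl⟩, h⟩ := this
      exact ⟨y, hy, h⟩
    choose y hyA hyd using this
    have hlim : Filter.Tendsto (fun i => f (y i)) Filter.atTop (nhds p) := by
      rw [tendsto_iff_dist_tendsto_zero]
      refine squeeze_zero (fun _ => dist_nonneg) (fun i => ?_) tendsto_one_div_add_atTop_nhds_zero_nat
      rw [dist_comm]; exact (hyd i).le
    let y' : ℕ → ℕ → ℕ := fun i j => if j < i then y i j else 0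
    have hy'K : ∀ i, y' i ∈ K := by
      intro i j _
      simp only [y', Set.mem_Iic]
      split_ifs with h
      · have := hyA i
        rw [hAeq] at this
        exact this j h
      · exact Nat.zero_le _
    obtain ⟨x, hxK, φ, hφ, hx⟩ := hK.tendsto_subseq hy'K
    have hyx : Filter.Tendsto (fun i => y (φ i)) Filter.atTop (nhds x) := by
      rw [tendsto_pi_nhds] at hx ⊢
      intro j
      refine (hx j).congr' ?_
      filter_upwards [Filter.eventually_gt_atTop j] with i hi
      have : j < φ i := lt_of_lt_of_le hi (hφ.id_le i)
      simp [y', this]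
    refine ⟨x, hxK, ?_⟩
    exact tendsto_nhds_unique ((hf.tendsto x).comp hyx) (hlim.comp hφ.tendsto_atTop)
  refine le_trans ?_ (measure_mono hsub)
  have hanti : Antitone fun i => closure (f '' (A i)) := by
    apply antitone_nat_of_succ_le
    intro i
    exact closure_mono (Set.image_mono (by rw [hA1]; exact Set.inter_subset_left))
  refine ge_of_tendsto' (tendsto_measure_iInter_atTop (μ := μ)
    (fun i => isClosed_closure.measurableSet.nullMeasurableSet) hanti ⟨0, measure_ne_top _ _⟩) ?_
  intro i
  exact (hA i).le.trans (measure_mono subset_closure)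

lemma measurable_nat_find_dite {P : Type*} [MeasurableSpace P] (F : ℕ → Set P)
    (hF : ∀ a, MeasurableSet (F a)) :
    ∃ a : P → ℕ, Measurable a ∧ ∀ p, (∃ b, p ∈ F b) → p ∈ F (a p) ∧ ∀ b < a p, p ∉ F b := by
  classical
  let F' : ℕ → Set P := fun n => F n ∪ (⋃ b, F b)ᶜ
  have hF' : ∀ p, ∃ n, p ∈ F' n := by
    intro p
    by_cases h : p ∈ ⋃ b, F b
    · obtain ⟨b, hb⟩ := Set.mem_iUnion.1 h
      exact ⟨b, Or.inl hb⟩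
    · exact ⟨0, Or.inr h⟩
  refine ⟨fun p => Nat.find (hF' p), measurable_find hF'
    (fun n => (hF n).union (MeasurableSet.iUnion hF).compl), ?_⟩
  intro p hp
  have hp' : p ∈ ⋃ b, F b := Set.mem_iUnion.2 hp
  refine ⟨?_, ?_⟩
  · rcases Nat.find_spec (hF' p) with h | h
    · exact h
    · exact absurd hp' h
  · intro b hb h
    exact Nat.find_min (hF' p) hb (Or.inl h)

lemma exists_selection_compact {P : Type*} [TopologicalSpace P] [T2Space P]
    [MeasurableSpace P] [BorelSpace P]
    (f : (ℕ → ℕ) → P) (hf : Continuous f) (K : Set (ℕ → ℕ)) (hK : IsCompact K) :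
    ∃ σ : P → (ℕ → ℕ), Measurable σ ∧ ∀ p ∈ f '' K, f (σ p) = p := by
  classical
  letI : MeasurableSpace (List ℕ) := ⊤
  haveI : DiscreteMeasurableSpace (List ℕ) := ⟨fun _ => trivial⟩
  let cyl : List ℕ → Set (ℕ → ℕ) := fun l => {x | (List.range l.length).map x = l}
  have hcyl : ∀ l, IsClosed (cyl l) := by
    intro l
    have : Continuous fun x : ℕ → ℕ => fun i : Fin l.length => x i := by fun_prop
    have h2 : cyl l = (fun x : ℕ → ℕ => fun i : Fin l.length => x i) ⁻¹' {fun i => l.get i} := by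
      ext x
      simp only [cyl, Set.mem_setOf_eq, Set.mem_preimage, Set.mem_singleton_iff]
      constructor
      · intro h
        funext i
        have := List.getElem_of_eq h (i := i) (by simp)
        simpa using this
      · intro h
        apply List.ext_getElem (by simp)
        intro i h1 h2
        have := congrFun h ⟨i, h2⟩
        simpa using this
    rw [h2]
    exact isClosed_singleton.preimage this
  let F : List ℕ → Set P := fun l => f '' (K ∩ cyl l)
  have hF : ∀ l, MeasurableSet (F l) := fun l =>
    ((hK.inter_right (hcyl l)).image hf).isClosed.measurableSet
  have := fun l : List ℕ => measurable_nat_find_dite (fun a => F (l ++ [a])) (fun a => hF _)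
  choose a ham ha using this
  let s : ℕ → P → List ℕ := fun n => Nat.rec (fun _ => []) (fun _ s p => s p ++ [a (s p) p]) n
  have hs0 : ∀ p, s 0 p = [] := fun _ => rfl
  have hs1 : ∀ n p, s (n + 1) p = s n p ++ [a (s n p) p] := fun _ _ => rfl
  have hlen : ∀ n p, (s n p).length = n := by
    intro n p
    induction n with
    | zero => simp [hs0]
    | succ n ih => simp [hs1, ih]
  have hunc : Measurable (fun q : List ℕ × P => a q.1 q.2) :=
    measurable_from_prod_countable_right (fun l => ham l)
  have hsm : ∀ n, Measurable (s n) := by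
    intro n
    induction n with
    | zero => exact measurable_const
    | succ n ih =>
      have h1 : Measurable fun p => a (s n p) p := hunc.comp (ih.prodMk measurable_id)
      have h2 : Measurable fun q : List ℕ × ℕ => q.1 ++ [q.2] := measurable_of_countable _
      exact h2.comp (ih.prodMk h1)
  have hmem : ∀ p ∈ f '' K, ∀ n, p ∈ F (s n p) := by
    intro p hp n
    induction n with
    | zero => simpa [F, cyl, hs0] using hp
    | succ n ih =>
      rw [hs1]
      apply (ha (s n p) p ?_).1
      obtain ⟨x, ⟨hxK, hx⟩, rfl⟩ := ih
      refine ⟨x (s n (f x)).length, x, ⟨hxK, ?_⟩, rfl⟩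
      simp only [cyl, Set.mem_setOf_eq] at hx ⊢
      rw [List.length_append, List.length_singleton, List.range_succ, List.map_append, hx]
      rfl
  let σ : P → ℕ → ℕ := fun p n => a (s n p) p
  have hσs : ∀ p n, (List.range n).map (σ p) = s n p := by
    intro p n
    induction n with
    | zero => rfl
    | succ n ih => rw [List.range_succ, List.map_append, ih, hs1]; rfl
  refine ⟨σ, measurable_pi_iff.2 fun n => hunc.comp ((hsm n).prodMk measurable_id), ?_⟩
  intro p hp
  have := fun n => hmem p hp n
  choose x hx hxp using this
  have hlim : Filter.Tendsto x Filter.atTop (nhds (σ p)) := by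
    rw [tendsto_pi_nhds]
    intro j
    refine tendsto_const_nhds.congr' ?_
    filter_upwards [Filter.eventually_gt_atTop j] with n hn
    have h1 := (hx n).2
    simp only [cyl, Set.mem_setOf_eq, hlen] at h1
    rw [← hσs p n] at h1
    have := List.getElem_of_eq h1 (i := j) (by simpa using hn)
    simpa using this.symm
  have h2 := (hf.tendsto (σ p)).comp hlim
  refine tendsto_nhds_unique h2 ?_
  refine tendsto_const_nhds.congr fun n => (hxp n).symm

/-- Measurable selection up to null sets. -/
lemma exists_selection {P X : Type*} [MeasurableSpace P] [StandardBorelSpace P]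
    [MeasurableSpace X] [StandardBorelSpace X] [Nonempty X]
    (μ : Measure P) [IsFiniteMeasure μ] (B : Set (P × X)) (hB : MeasurableSet B) :
    ∃ (M : Set P) (s : P → X), MeasurableSet M ∧ Measurable s ∧ (∀ p ∈ M, (p, s p) ∈ B) ∧
      ∀ᵐ p ∂μ, (∃ x, (p, x) ∈ B) → p ∈ M := by
  letI := upgradeStandardBorel P
  letI := upgradeStandardBorel X
  have hBa : AnalyticSet B := hB.analyticSet
  rw [AnalyticSet] at hBa
  rcases hBa with rfl | ⟨g, hg, rfl⟩
  · exact ⟨∅, fun _ => Classical.arbitrary X, MeasurableSet.empty, measurable_const, by simp,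
      by simp⟩
  let f : (ℕ → ℕ) → P := fun x => (g x).1
  have hf : Continuous f := continuous_fst.comp hg
  have key : ∀ r : ℝ≥0∞, r < μ (Set.range f) → ∃ K, IsCompact K ∧ r ≤ μ (f '' K) := fun r hr =>
    exists_compact_image μ f hf r hr
  have : ∃ K : ℕ → Set (ℕ → ℕ), (∀ n, IsCompact (K n)) ∧
      μ (Set.range f) ≤ μ (⋃ n, f '' (K n)) := by
    by_cases h0 : μ (Set.range f) = 0
    · exact ⟨fun _ => ∅, fun _ => isCompact_empty, by simp [h0]⟩
    obtain ⟨u, -, hu, hut⟩ := exists_seq_strictMono_tendsto' (pos_iff_ne_zero.2 h0)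
    choose K hK hKr using fun n => key (u n) (hu n).2
    refine ⟨K, hK, le_of_tendsto' hut fun n => (hKr n).trans (measure_mono ?_)⟩
    exact Set.subset_iUnion (fun n => f '' (K n)) n
  obtain ⟨K, hK, hKμ⟩ := this
  choose σ hσ hσf using fun n => exists_selection_compact f hf (K n) (hK n)
  have hMn : ∀ n, MeasurableSet (f '' (K n)) := fun n => ((hK n).image hf).isClosed.measurableSet
  obtain ⟨a, ham, ha⟩ := measurable_nat_find_dite (fun n => f '' (K n)) hMn
  have hM : MeasurableSet (⋃ n, f '' (K n)) := MeasurableSet.iUnion hMn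
  refine ⟨⋃ n, f '' (K n), fun p => (g (σ (a p) p)).2, hM, ?_, ?_, ?_⟩
  · have h1 : Measurable fun q : ℕ × P => σ q.1 q.2 :=
      measurable_from_prod_countable_right (fun l => hσ l)
    exact (continuous_snd.comp hg).measurable.comp (h1.comp (ham.prodMk measurable_id))
  · intro p hp
    have h1 := (ha p (Set.mem_iUnion.1 hp)).1
    have h2 : (g (σ (a p) p)).1 = p := hσf _ p h1
    refine ⟨σ (a p) p, ?_⟩
    exact Prod.ext h2 rfl
  · have h1 : μ (Set.range f \ ⋃ n, f '' (K n)) = 0 := by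
      have h2 := measure_inter_add_diff (μ := μ) (Set.range f) hM
      have h3 : Set.range f ∩ (⋃ n, f '' (K n)) = ⋃ n, f '' (K n) := by
        apply Set.inter_eq_right.2
        exact Set.iUnion_subset fun n => Set.image_subset_range _ _
      rw [h3] at h2
      have h4 : μ (⋃ n, f '' (K n)) + μ (Set.range f \ ⋃ n, f '' (K n))
          ≤ μ (⋃ n, f '' (K n)) + 0 := by
        rw [h2, add_zero]; exact hKμ
      exact le_antisymm ((ENNReal.add_le_add_iff_left (measure_ne_top _ _)).1 h4) zero_le
    rw [ae_iff]
    refine measure_mono_null ?_ h1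
    intro p hp
    simp only [Set.mem_setOf_eq, Classical.not_imp] at hp
    obtain ⟨⟨x, y, hy⟩, h2⟩ := hp
    exact ⟨⟨y, by simp [f, hy]⟩, h2⟩

/-- near-optimal selection. -/
lemma exists_near_opt {P X : Type*} [MeasurableSpace P] [StandardBorelSpace P]
    [MeasurableSpace X] [StandardBorelSpace X] [Nonempty X]
    (μ : Measure P) [IsFiniteMeasure μ] (D : Set (P × X)) (hD : MeasurableSet D)
    (H : X → ℝ≥0∞) (hH : Measurable H) (V : P → ℝ≥0∞) (hV : ∀ p, V p ≠ ∞)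
    (hVD : ∀ p t, V p < t → ∃ x, (p, x) ∈ D ∧ H x < t) (ε : ℝ≥0∞) (hε : ε ≠ 0) :
    ∃ s : P → X, Measurable s ∧ ∀ᵐ p ∂μ, (p, s p) ∈ D ∧ H (s p) ≤ V p + ε := by
  let B : ℕ → Set (P × X) := fun k => D ∩ {q | H q.2 < (k : ℝ≥0∞) * ε}
  have hB : ∀ k, MeasurableSet (B k) := fun k =>
    hD.inter (measurableSet_lt (hH.comp measurable_snd) measurable_const)
  choose M s hM hs hsB hae using fun k => exists_selection μ (B k) (hB k)
  obtain ⟨a, ham, ha⟩ := measurable_nat_find_dite M hM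
  have h1 : Measurable fun q : ℕ × P => s q.1 q.2 :=
      measurable_from_prod_countable_right (fun l => hs l)
  refine ⟨fun p => s (a p) p, h1.comp (ham.prodMk measurable_id), ?_⟩
  filter_upwards [ae_all_iff.2 hae] with p hp
  have hex : ∀ k : ℕ, V p < k * ε → p ∈ M k := by
    intro k hk
    obtain ⟨x, hx, hxH⟩ := hVD p _ hk
    exact hp k ⟨x, hx, hxH⟩
  have hex2 : ∃ k, p ∈ M k := by
    obtain ⟨k, hk⟩ := ENNReal.exists_nat_mul_gt hε (hV p)
    exact ⟨k, hex k hk⟩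
  obtain ⟨h2, h3⟩ := ha p hex2
  have h4 := hsB _ p h2
  refine ⟨h4.1, (show H (s (a p) p) < a p * ε from h4.2).le.trans ?_⟩
  rcases Nat.eq_zero_or_eq_succ_pred (a p) with h0 | h0
  · rw [h0]; simp
  · have h5 := h3 (a p - 1) (by omega)
    have h6 : (a p - 1 : ℕ) * ε ≤ V p := by
      by_contra hcon
      exact h5 (hex _ (not_le.1 hcon))
    have h7 : a p = (a p - 1) + 1 := by omega
    rw [h7, Nat.cast_add, add_mul, Nat.cast_one, one_mul]
    gcongr

/-- A universal Markov kernel, parametrizing all probability measures. -/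
lemma exists_universal_kernel (Ω : Type*) [MeasurableSpace Ω] [StandardBorelSpace Ω] [Nonempty Ω] :
    ∃ U : Kernel (ℚ → ℝ) Ω, IsMarkovKernel U ∧
      ∀ m : Measure Ω, IsProbabilityMeasure m → ∃ x, U x = m := by
  let U₀ : Kernel (ℚ → ℝ) ℝ :=
    ⟨fun x => (stieltjesOfMeasurableRat (fun x : ℚ → ℝ => x) measurable_id x).measure,
      measurable_measure_stieltjesOfMeasurableRat measurable_id⟩
  have hU₀ : IsMarkovKernel U₀ :=
    ⟨fun x => instIsProbabilityMeasure_stieltjesOfMeasurableRat measurable_id x⟩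
  have he := measurableEmbedding_embeddingReal Ω
  obtain ⟨g, hg, hge⟩ := he.exists_measurable_extend (measurable_id (α := Ω))
    (fun _ => inferInstance)
  refine ⟨U₀.map g, Kernel.IsMarkovKernel.map _ hg, ?_⟩
  intro m hm
  let ν := m.map (embeddingReal Ω)
  have hν : IsProbabilityMeasure ν := Measure.isProbabilityMeasure_map he.measurable.aemeasurable
  let x : ℚ → ℝ := fun q => cdf ν q
  have hx : IsRatStieltjesPoint (fun x : ℚ → ℝ => x) x := by
    refine ⟨fun a b hab => (cdf ν).mono (by exact_mod_cast hab), ?_, ?_, ?_⟩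
    · exact (tendsto_cdf_atTop ν).comp (tendsto_ratCast_atTop_iff.2 Filter.tendsto_id)
    · exact (tendsto_cdf_atBot ν).comp (tendsto_ratCast_atBot_iff.2 Filter.tendsto_id)
    · intro t
      have := (cdf ν).iInf_rat_gt_eq t
      change ⨅ r : Set.Ioi t, cdf ν ((r : ℚ) : ℝ) = cdf ν t
      rw [← this]
      refine Equiv.iInf_congr (Equiv.subtypeEquivRight fun r => ?_) fun r => rfl
      exact (Rat.cast_lt (K := ℝ)).symm
  have hU : U₀ x = ν := by
    rw [← measure_cdf ν]
    change (stieltjesOfMeasurableRat (fun x : ℚ → ℝ => x) measurable_id x).measure = _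
    congr 1
    ext r
    rw [← StieltjesFunction.iInf_rat_gt_eq, ← StieltjesFunction.iInf_rat_gt_eq]
    congr 1
    ext q
    rw [stieltjesOfMeasurableRat_eq, toRatCDF_of_isRatStieltjesPoint hx]
  refine ⟨x, ?_⟩
  rw [Kernel.map_apply _ hg, hU, Measure.map_map hg he.measurable, hge, Measure.map_id]

lemma measurableSet_kernel_eq {X Y : Type*} [MeasurableSpace X] [MeasurableSpace Y]
    [StandardBorelSpace Y] (κ η : Kernel X Y) [IsMarkovKernel κ] [IsMarkovKernel η] :
    MeasurableSet {x | κ x = η x} := by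
  have he := measurableEmbedding_embeddingReal Y
  have : {x | κ x = η x} = ⋂ q : ℚ, {x | κ x (embeddingReal Y ⁻¹' Set.Iic (q : ℝ))
      = η x (embeddingReal Y ⁻¹' Set.Iic (q : ℝ))} := by
    ext x
    simp only [Set.mem_iInter]
    constructor
    · intro (h : κ x = η x) q
      change κ x _ = η x _
      rw [h]
    · intro h
      change κ x = η x
      have h2 : (κ x).map (embeddingReal Y) = (η x).map (embeddingReal Y) := by
        refine ext_of_generate_finite _ ((BorelSpace.measurable_eq (α := ℝ)).trans
          Real.borel_eq_generateFrom_Iic_rat) Real.isPiSystem_Iic_rat ?_ ?_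
        · intro s hs
          simp only [Set.mem_iUnion, Set.mem_singleton_iff] at hs
          obtain ⟨q, rfl⟩ := hs
          rw [Measure.map_apply he.measurable measurableSet_Iic,
            Measure.map_apply he.measurable measurableSet_Iic]
          exact h q
        · rw [Measure.map_apply he.measurable MeasurableSet.univ,
            Measure.map_apply he.measurable MeasurableSet.univ]
          simp
      have h3 := congrArg (Measure.comap (embeddingReal Y)) h2
      rwa [he.comap_map, he.comap_map] at h3
  rw [this]
  refine MeasurableSet.iInter fun q => ?_
  have hm := he.measurable (measurableSet_Iic (a := (q : ℝ)))
  exact measurableSet_eq_fun (κ.measurable_coe hm) (η.measurable_coe hm)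

/-! ### Generic facts about composition products -/

lemma map_compProd_left {A B Z : Type*} [MeasurableSpace A] [MeasurableSpace B] [MeasurableSpace Z]
    (μ : Measure A) [IsProbabilityMeasure μ] (f : A → B) (hf : Measurable f)
    (κ : Kernel B Z) [IsMarkovKernel κ] :
    (μ.map f) ⊗ₘ κ = (μ ⊗ₘ (κ.comap f hf)).map (Prod.map f id) := by
  have : IsProbabilityMeasure (μ.map f) := Measure.isProbabilityMeasure_map hf.aemeasurable
  ext s hs
  have hm : Measurable (Prod.map f (id : Z → Z)) := hf.prodMap measurable_id
  rw [Measure.compProd_apply hs, Measure.map_apply hm hs, Measure.compProd_apply (hm hs),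
    lintegral_map (Kernel.measurable_kernel_prodMk_left hs) hf]
  rfl

lemma push_step {Ω A B Z : Type*} [MeasurableSpace Ω] [MeasurableSpace A] [MeasurableSpace B]
    [MeasurableSpace Z] (π : Measure Ω) [IsProbabilityMeasure π] (f : Ω → A) (hf : Measurable f)
    (g : A → B) (hg : Measurable g) (X : Ω → Z) (hX : Measurable X)
    (κ : Kernel B Z) [IsMarkovKernel κ]
    (h : π.map (fun ω => (f ω, X ω)) = (π.map f) ⊗ₘ (κ.comap g hg)) :
    π.map (fun ω => (g (f ω), X ω)) = (π.map (fun ω => g (f ω))) ⊗ₘ κ := by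
  have : IsProbabilityMeasure (π.map f) := Measure.isProbabilityMeasure_map hf.aemeasurable
  have h1 : π.map (fun ω => g (f ω)) = (π.map f).map g := (Measure.map_map hg hf).symm
  rw [h1, map_compProd_left (π.map f) g hg κ, ← h,
    Measure.map_map (hg.prodMap measurable_id) (hf.prodMk hX)]
  rfl

lemma bind_step {P Ω A Z : Type*} [MeasurableSpace P] [MeasurableSpace Ω] [MeasurableSpace A]
    [MeasurableSpace Z] (π₀ : Measure P) [IsProbabilityMeasure π₀] (K : Kernel P Ω)
    [IsMarkovKernel K] (f : Ω → A) (hf : Measurable f) (X : Ω → Z) (hX : Measurable X)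
    (κ : Kernel A Z) [IsMarkovKernel κ]
    (h : ∀ᵐ p ∂π₀, (K p).map (fun ω => (f ω, X ω)) = ((K p).map f) ⊗ₘ κ) :
    (K ∘ₘ π₀).map (fun ω => (f ω, X ω)) = ((K ∘ₘ π₀).map f) ⊗ₘ κ := by
  have : IsMarkovKernel (K.map f) := Kernel.IsMarkovKernel.map _ hf
  rw [Measure.map_comp _ _ (hf.prodMk hX), Measure.map_comp _ _ hf,
    Measure.compProd_eq_comp_prod, Measure.comp_assoc]
  apply Measure.comp_congr
  filter_upwards [h] with p hp
  have : IsProbabilityMeasure ((K p).map f) := Measure.isProbabilityMeasure_map hf.aemeasurable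
  rw [Kernel.map_apply _ (hf.prodMk hX), hp, Kernel.comp_apply, Kernel.map_apply _ hf,
    Measure.compProd_eq_comp_prod]

/-! ### Path measures -/

/-- append a state to a path -/
def snocMap {E : Type*} (n : ℕ) (q : (Fin (n + 1) → E) × E) : Fin (n + 1 + 1) → E :=
  Fin.snoc (α := fun _ => E) q.1 q.2

lemma measurable_snocMap {E : Type*} [MeasurableSpace E] (n : ℕ) :
    Measurable (snocMap (E := E) n) := by
  rw [measurable_pi_iff]
  intro i
  refine Fin.lastCases ?_ (fun j => ?_) i
  · simp only [snocMap, Fin.snoc_last]; fun_prop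
  · simp only [snocMap, Fin.snoc_castSucc]; fun_prop

section path
variable {E : Type*} [MeasurableSpace E] (π₀ : Measure E) [IsProbabilityMeasure π₀]
  (Q : ℕ → Kernel E E) [∀ n, IsMarkovKernel (Q n)]

/-- last coordinate kernel -/
def lastKer (n : ℕ) : Kernel (Fin (n + 1) → E) E :=
  (Q (n + 1)).comap (fun h => h (Fin.last n)) (measurable_pi_apply _)

instance (n : ℕ) : IsMarkovKernel (lastKer Q n) := by unfold lastKer; infer_instance

lemma pathMeasure_succ_aux (n : ℕ) (h : SFinite (pathMeasure π₀ Q n)) :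
    pathMeasure π₀ Q (n + 1) = ((pathMeasure π₀ Q n) ⊗ₘ (lastKer Q n)).map (snocMap n) := by
  rw [Measure.compProd_eq_comp_prod, Measure.map_comp _ _ (measurable_snocMap n)]
  change (pathMeasure π₀ Q n).bind _ = (pathMeasure π₀ Q n).bind _
  congr 1
  funext h
  rw [Kernel.map_apply _ (measurable_snocMap n), Kernel.prod_apply, Kernel.id_apply,
    Measure.dirac_prod, Measure.map_map (measurable_snocMap n) (by fun_prop)]
  rfl

instance pathMeasure_prob (n : ℕ) : IsProbabilityMeasure (pathMeasure π₀ Q n) := by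
  induction n with
  | zero =>
    rw [pathMeasure]
    exact Measure.isProbabilityMeasure_map (by fun_prop)
  | succ n ih =>
    rw [pathMeasure_succ_aux π₀ Q n inferInstance]
    exact Measure.isProbabilityMeasure_map (measurable_snocMap n).aemeasurable

lemma pathMeasure_succ (n : ℕ) :
    pathMeasure π₀ Q (n + 1) = ((pathMeasure π₀ Q n) ⊗ₘ (lastKer Q n)).map (snocMap n) :=
  pathMeasure_succ_aux π₀ Q n inferInstance

lemma pathMeasure_restrict (n N : ℕ) (hn : n ≤ N) :
    (pathMeasure π₀ Q N).map (fun h (i : Fin (n + 1)) => h (Fin.castLE (by omega) i))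
      = pathMeasure π₀ Q n := by
  induction N, hn using Nat.le_induction with
  | base => simp
  | succ N hN ih =>
    rw [pathMeasure_succ, Measure.map_map (by fun_prop) (measurable_snocMap N), ← ih]
    have : (fun (h : Fin (N + 1 + 1) → E) (i : Fin (n + 1)) => h (Fin.castLE (by omega) i))
        ∘ snocMap N = (fun (h : Fin (N + 1) → E) (i : Fin (n + 1)) =>
          h (Fin.castLE (by omega) i)) ∘ Prod.fst := by
      funext q i
      have : (Fin.castLE (by omega) i : Fin (N + 1 + 1))
        = Fin.castSucc (Fin.castLE (by omega) i : Fin (N + 1)) := rfl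
      simp only [Function.comp, snocMap, this, Fin.snoc_castSucc]
    rw [this, ← Measure.map_map (by fun_prop) measurable_fst]
    congr 1
    exact Measure.fst_compProd _ _

/-- one-time marginals -/
def marg : ℕ → Measure E
  | 0 => π₀
  | n + 1 => (Q (n + 1)) ∘ₘ (marg n)

lemma pathMeasure_last (n : ℕ) :
    (pathMeasure π₀ Q n).map (fun h => h (Fin.last n)) = marg π₀ Q n := by
  induction n with
  | zero =>
    rw [pathMeasure, Measure.map_map (by fun_prop) (by fun_prop)]
    exact Measure.map_id
  | succ n ih =>
    rw [pathMeasure_succ, Measure.map_map (by fun_prop) (measurable_snocMap n), marg, ← ih]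
    have : (fun (h : Fin (n + 1 + 1) → E) => h (Fin.last (n + 1))) ∘ snocMap n = Prod.snd := by
      funext q
      simp only [Function.comp, snocMap, Fin.snoc_last]
    rw [this]
    change ((pathMeasure π₀ Q n) ⊗ₘ (lastKer Q n)).snd = _
    rw [Measure.snd_compProd]
    ext s hs
    rw [Measure.bind_apply hs (Kernel.aemeasurable _), Measure.bind_apply hs (Kernel.aemeasurable _),
      lintegral_map ((Q (n + 1)).measurable_coe hs) (by fun_prop)]
    rfl

lemma pathMeasure_eval (N : ℕ) (i : Fin (N + 1)) :
    (pathMeasure π₀ Q N).map (fun h => h i) = marg π₀ Q i := by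
  rw [← pathMeasure_last, ← pathMeasure_restrict π₀ Q i N (by omega),
    Measure.map_map (by fun_prop) (by fun_prop)]
  rfl

lemma measurable_Jback (c : ℕ → E → ℝ≥0∞) (hc : ∀ n, Measurable (c n)) (N m : ℕ) :
    Measurable (Jback c Q N m) := by
  induction m with
  | zero => exact hc N
  | succ m ih => exact (hc _).add ih.lintegral_kernel

omit [IsProbabilityMeasure π₀] in
lemma lintegral_Jback (c : ℕ → E → ℝ≥0∞) (hc : ∀ n, Measurable (c n)) (N m : ℕ) (hm : m ≤ N) :
    ∫⁻ p, Jback c Q N m p ∂(marg π₀ Q (N - m))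
      = ∑ i ∈ Finset.Ico (N - m) (N + 1), ∫⁻ p, c i p ∂(marg π₀ Q i) := by
  induction m with
  | zero => simp [Jback]
  | succ m ih =>
    rw [Finset.sum_eq_sum_Ico_succ_bot (by omega)]
    have h1 : N - (m + 1) + 1 = N - m := by omega
    rw [h1, ← ih (by omega)]
    simp only [Jback]
    rw [lintegral_add_left (hc _)]
    congr 1
    have h2 : marg π₀ Q (N - m) = (Q (N - m)) ∘ₘ (marg π₀ Q (N - (m + 1))) := by
      rw [← h1]; rfl
    rw [h2, Measure.lintegral_bind (Kernel.aemeasurable _)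
      (measurable_Jback Q c hc N m).aemeasurable]

/-- a process satisfying the one-step condition has the Markov path law -/
lemma map_eq_pathMeasure {Ω : Type*} [MeasurableSpace Ω] (π : Measure Ω) [IsProbabilityMeasure π]
    (N : ℕ) (X : Ω → Fin (N + 1) → E) (hX : Measurable X)
    (h0 : π.map (fun ω => X ω 0) = π₀)
    (hstep : ∀ n (hn : n + 1 ≤ N),
      π.map (fun ω => ((fun i : Fin (n + 1) => X ω (Fin.castLE (by omega) i)),
          X ω ⟨n + 1, by omega⟩))
        = (π.map (fun ω => (fun i : Fin (n + 1) => X ω (Fin.castLE (by omega) i))))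
          ⊗ₘ (lastKer Q n)) :
    π.map X = pathMeasure π₀ Q N := by
  have key : ∀ n (hn : n ≤ N),
      π.map (fun ω => (fun i : Fin (n + 1) => X ω (Fin.castLE (by omega) i)))
        = pathMeasure π₀ Q n := by
    intro n
    induction n with
    | zero =>
      intro hn
      rw [pathMeasure, ← h0, Measure.map_map (by fun_prop) (by fun_prop)]
      congr 1
      funext ω i
      have : i = 0 := by ext; have := i.2; simp only [Fin.val_zero]; omega
      subst this
      rfl
    | succ n ih =>
      intro hn
      rw [pathMeasure_succ, ← ih (by omega), ← hstep n hn,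
        Measure.map_map (measurable_snocMap n) (by fun_prop)]
      congr 1
      funext ω i
      refine Fin.lastCases ?_ (fun j => ?_) i
      · simp only [Function.comp, snocMap, Fin.snoc_last]; rfl
      · simp only [Function.comp, snocMap, Fin.snoc_castSucc]; rfl
  simpa using key N le_rfl

end path

lemma pathMeasure_congr {E : Type*} [MeasurableSpace E] (π₀ : Measure E)
    (Q Q' : ℕ → Kernel E E) (N : ℕ) (h : ∀ n, 1 ≤ n → n ≤ N → Q n = Q' n) :
    pathMeasure π₀ Q N = pathMeasure π₀ Q' N := by
  induction N with
  | zero => rfl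
  | succ n ih =>
    rw [pathMeasure, pathMeasure, ih (fun m h1 h2 => h m h1 (by omega)), h (n + 1) (by omega) le_rfl]

lemma Jback_congr {E : Type*} [MeasurableSpace E] (c : ℕ → E → ℝ≥0∞)
    (Q Q' : ℕ → Kernel E E) (N : ℕ) (h : ∀ n, 1 ≤ n → n ≤ N → Q n = Q' n) (m : ℕ) (hm : m ≤ N) :
    Jback c Q N m = Jback c Q' N m := by
  induction m with
  | zero => rfl
  | succ m ih =>
    rw [Jback, Jback, ih (by omega), h (N - m) (by omega) (by omega)]

/-! ### Couplings -/

section coupl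
variable {d N : ℕ}

/-- pair of states at time `i` -/
def evp (i : Fin (N + 1)) (ω : Pth d N × Pth d N) : Stt d × Stt d := (ω.1 i, ω.2 i)

lemma measurable_evp (i : Fin (N + 1)) : Measurable (evp (d := d) i) := by
  unfold evp; fun_prop

lemma measurable_prefixPair (n : ℕ) (hn : n ≤ N + 1) : Measurable (prefixPair (d := d) n hn) := by
  unfold prefixPair; fun_prop

lemma measurable_splitPath {S : Type*} [MeasurableSpace S] {n : ℕ} :
    Measurable (splitPath (S := S) (n := n)) := by
  unfold splitPath; fun_prop

/-- The one-step part of bi-causality. -/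
def StepCond (T T' : ℕ → Kernel (Stt d) (Stt d)) (π : Measure (Pth d N × Pth d N)) : Prop :=
  ∀ n, ∀ _ : 1 ≤ n, ∀ hn : n ≤ N,
    (π.map (fun ω => (prefixPair n (by omega) ω, ω.1 ⟨n, by omega⟩))
        = (π.map (prefixPair n (by omega)))
            ⊗ₘ ((T n).comap (fun x : (Fin n → Stt d) × (Fin n → Stt d) =>
                  x.1 ⟨n - 1, by omega⟩) (by fun_prop))) ∧
    (π.map (fun ω => (prefixPair n (by omega) ω, ω.2 ⟨n, by omega⟩))
        = (π.map (prefixPair n (by omega)))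
            ⊗ₘ ((T' n).comap (fun x : (Fin n → Stt d) × (Fin n → Stt d) =>
                  x.2 ⟨n - 1, by omega⟩) (by fun_prop)))

lemma totalCost_eq (c : ℕ → Stt d × Stt d → ℝ≥0∞) (hc : ∀ n, Measurable (c n))
    (π : Measure (Pth d N × Pth d N)) :
    totalCost c π = ∑ i : Fin (N + 1), ∫⁻ p, c i p ∂(π.map (evp i)) := by
  change ∫⁻ ω, ∑ i : Fin (N + 1), (c i ∘ evp i) ω ∂π = _
  rw [lintegral_finsetSum _ (fun (i : Fin (N + 1)) _ => (hc i).comp (measurable_evp (d := d) i))]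
  refine Finset.sum_congr rfl fun i _ => ?_
  rw [lintegral_map (hc i) (measurable_evp i)]
  rfl

lemma totalCost_of_marg (c : ℕ → Stt d × Stt d → ℝ≥0∞) (hc : ∀ n, Measurable (c n))
    (π : Measure (Pth d N × Pth d N)) (π₀ : Measure (Stt d × Stt d))
    (Q : ℕ → Kernel (Stt d × Stt d) (Stt d × Stt d)) [∀ n, IsMarkovKernel (Q n)]
    (h : ∀ i : Fin (N + 1), π.map (evp i) = marg π₀ Q i) :
    totalCost c π = ∫⁻ p, Jback c Q N N p ∂π₀ := by
  have h1 := lintegral_Jback π₀ Q c hc N N le_rfl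
  rw [Nat.sub_self] at h1
  rw [totalCost_eq c hc]
  simp only [h]
  rw [show marg π₀ Q 0 = π₀ from rfl] at h1
  rw [h1, ← Finset.range_eq_Ico]
  exact Fin.sum_univ_eq_sum_range (fun i => ∫⁻ p, c i p ∂(marg π₀ Q i)) (N + 1)

/-- The Markov coupling. -/
def mk (N : ℕ) (π₀ : Measure (Stt d × Stt d))
    (Q : ℕ → Kernel (Stt d × Stt d) (Stt d × Stt d)) : Measure (Pth d N × Pth d N) :=
  (pathMeasure π₀ Q N).map splitPath

section mkk
variable (π₀ : Measure (Stt d × Stt d)) [IsProbabilityMeasure π₀]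
    (Q : ℕ → Kernel (Stt d × Stt d) (Stt d × Stt d)) [∀ n, IsMarkovKernel (Q n)]

instance mk_prob : IsProbabilityMeasure (mk N π₀ Q) :=
  Measure.isProbabilityMeasure_map measurable_splitPath.aemeasurable

lemma mk_evp (i : Fin (N + 1)) : (mk N π₀ Q).map (evp i) = marg π₀ Q i := by
  rw [mk, Measure.map_map (measurable_evp i) measurable_splitPath, ← pathMeasure_eval π₀ Q N i]
  rfl

lemma mk_step (T T' : ℕ → Kernel (Stt d) (Stt d)) [∀ n, IsMarkovKernel (T n)]
    [∀ n, IsMarkovKernel (T' n)] (hQ : Q ∈ admissible T T' N) :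
    StepCond T T' (mk N π₀ Q) := by
  intro n hn1 hn
  obtain ⟨m, rfl⟩ : ∃ m, n = m + 1 := ⟨n - 1, by omega⟩
  obtain ⟨-, hQ'⟩ := hQ (m + 1) hn1 hn
  have hpre : (mk N π₀ Q).map (prefixPair (m + 1) (by omega))
      = (pathMeasure π₀ Q m).map splitPath := by
    rw [mk, Measure.map_map (measurable_prefixPair _ _) measurable_splitPath,
      ← pathMeasure_restrict π₀ Q m N (by omega),
      Measure.map_map measurable_splitPath (by fun_prop)]
    rfl
  have hjoint : ∀ g : Stt d × Stt d → Stt d, Measurable g →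
      (pathMeasure π₀ Q N).map (fun h => (splitPath (fun i : Fin (m + 1) =>
          h (Fin.castLE (by omega) i)), g (h ⟨m + 1, by omega⟩)))
        = ((pathMeasure π₀ Q m) ⊗ₘ ((lastKer Q m).map g)).map (Prod.map splitPath id) := by
    intro g hg
    have h1 : (pathMeasure π₀ Q N).map (fun h => (splitPath (fun i : Fin (m + 1) =>
          h (Fin.castLE (by omega) i)), g (h ⟨m + 1, by omega⟩)))
        = (pathMeasure π₀ Q (m + 1)).map (fun h => (splitPath (fun i : Fin (m + 1) =>
          h (Fin.castSucc i)), g (h (Fin.last (m + 1))))) := by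
      rw [← pathMeasure_restrict π₀ Q (m + 1) N hn, Measure.map_map _ (by fun_prop)]
      · rfl
      · exact (measurable_splitPath.comp (by fun_prop)).prodMk (by fun_prop)
    rw [h1, pathMeasure_succ, Measure.map_map _ (measurable_snocMap m), Measure.compProd_map hg,
      Measure.map_map (measurable_splitPath.prodMap measurable_id) (by fun_prop)]
    · congr 1
      funext q
      simp only [Function.comp, snocMap, Fin.snoc_last, Fin.snoc_castSucc]
      rfl
    · exact (measurable_splitPath.comp (by fun_prop)).prodMk (by fun_prop)
  constructor
  · rw [hpre, map_compProd_left _ _ measurable_splitPath, mk,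
      Measure.map_map ((measurable_prefixPair _ _).prodMk (by fun_prop)) measurable_splitPath]
    refine (hjoint Prod.fst measurable_fst).trans ?_
    congr 2
    ext1 h
    rw [Kernel.map_apply _ measurable_fst]
    exact (hQ' _ _).1
  · rw [hpre, map_compProd_left _ _ measurable_splitPath, mk,
      Measure.map_map ((measurable_prefixPair _ _).prodMk (by fun_prop)) measurable_splitPath]
    refine (hjoint Prod.snd measurable_snd).trans ?_
    congr 2
    ext1 h
    rw [Kernel.map_apply _ measurable_snd]
    exact (hQ' _ _).2

end mkk

variable (T T' : ℕ → Kernel (Stt d) (Stt d)) [∀ n, IsMarkovKernel (T n)]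
    [∀ n, IsMarkovKernel (T' n)]

lemma isBicausal_of_step (μ₀ μ₀' : Measure (Stt d)) [IsProbabilityMeasure μ₀]
    [IsProbabilityMeasure μ₀'] (π : Measure (Pth d N × Pth d N)) [IsProbabilityMeasure π]
    (hs : StepCond T T' π) (h0 : (π.map (evp 0)).map Prod.fst = μ₀)
    (h0' : (π.map (evp 0)).map Prod.snd = μ₀') :
    IsBicausal (pathMeasure μ₀ T N) (pathMeasure μ₀' T' N) T T' π := by
  rw [Measure.map_map (by fun_prop) (measurable_evp _)] at h0 h0'
  refine ⟨?_, ?_, hs⟩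
  · refine map_eq_pathMeasure μ₀ T π N Prod.fst measurable_fst h0 fun n hn => ?_
    exact push_step π (prefixPair (n + 1) (by omega)) (measurable_prefixPair _ _) Prod.fst
      measurable_fst (fun ω => ω.1 ⟨n + 1, by omega⟩) (by fun_prop) (lastKer T n)
      (hs (n + 1) (by omega) hn).1
  · refine map_eq_pathMeasure μ₀' T' π N Prod.snd measurable_snd h0' fun n hn => ?_
    exact push_step π (prefixPair (n + 1) (by omega)) (measurable_prefixPair _ _) Prod.snd
      measurable_snd (fun ω => ω.2 ⟨n + 1, by omega⟩) (by fun_prop) (lastKer T' n)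
      (hs (n + 1) (by omega) hn).2

/-- product coupling kernel -/
def prodKer (T T' : Kernel (Stt d) (Stt d)) : Kernel (Stt d × Stt d) (Stt d × Stt d) :=
  (T.comap Prod.fst measurable_fst) ×ₖ (T'.comap Prod.snd measurable_snd)

instance (T T' : Kernel (Stt d) (Stt d)) [IsMarkovKernel T] [IsMarkovKernel T'] :
    IsMarkovKernel (prodKer T T') := by unfold prodKer; infer_instance

lemma prodKer_mem (T T' : Kernel (Stt d) (Stt d)) [IsMarkovKernel T] [IsMarkovKernel T'] :
    prodKer T T' ∈ PiM T T' := by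
  refine ⟨inferInstance, fun y y' => ?_⟩
  rw [prodKer, Kernel.prod_apply]
  exact ⟨Measure.fst_prod, Measure.snd_prod⟩

lemma proj_step (T T' : Kernel (Stt d) (Stt d)) [IsMarkovKernel T] [IsMarkovKernel T']
    (ρ : Measure ((Stt d × Stt d) × (Stt d × Stt d))) [IsProbabilityMeasure ρ]
    (h1 : ρ.map (Prod.map id Prod.fst) = ρ.fst ⊗ₘ (T.comap Prod.fst measurable_fst))
    (h2 : ρ.map (Prod.map id Prod.snd) = ρ.fst ⊗ₘ (T'.comap Prod.snd measurable_snd)) :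
    ∃ Q ∈ PiM T T', Q ∘ₘ ρ.fst = ρ.snd := by
  classical
  have hρ : ρ.fst ⊗ₘ ρ.condKernel = ρ := ρ.disintegrate ρ.condKernel
  have e1 : ∀ᵐ p ∂ρ.fst, (ρ.condKernel.map Prod.fst) p =
      (T.comap (Prod.fst : Stt d × Stt d → Stt d) measurable_fst :
        Kernel (Stt d × Stt d) (Stt d)) p := by
    have := Kernel.IsMarkovKernel.map ρ.condKernel (measurable_fst (α := Stt d) (β := Stt d))
    refine Kernel.ae_eq_of_compProd_eq (κ := ρ.condKernel.map Prod.fst)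
      (η := T.comap (Prod.fst : Stt d × Stt d → Stt d) measurable_fst) ?_
    rw [Measure.compProd_map measurable_fst, hρ, h1]
  have e2 : ∀ᵐ p ∂ρ.fst, (ρ.condKernel.map Prod.snd) p =
      (T'.comap (Prod.snd : Stt d × Stt d → Stt d) measurable_snd :
        Kernel (Stt d × Stt d) (Stt d)) p := by
    have := Kernel.IsMarkovKernel.map ρ.condKernel (measurable_snd (α := Stt d) (β := Stt d))
    refine Kernel.ae_eq_of_compProd_eq (κ := ρ.condKernel.map Prod.snd)
      (η := T'.comap (Prod.snd : Stt d × Stt d → Stt d) measurable_snd) ?_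
    rw [Measure.compProd_map measurable_snd, hρ, h2]
  have e3 := e1.and e2
  obtain ⟨G, hGsub, hGm, hG⟩ := e3.exists_measurable_mem
  let Q := Kernel.piecewise hGm ρ.condKernel (prodKer T T')
  refine ⟨Q, ⟨inferInstance, fun y y' => ?_⟩, ?_⟩
  · by_cases hy : (y, y') ∈ G
    · have h3 := hG _ hy
      rw [Kernel.map_apply _ measurable_fst, Kernel.map_apply _ measurable_snd] at h3
      simp only [Q, Kernel.piecewise_apply, if_pos hy]
      exact h3
    · simp only [Q, Kernel.piecewise_apply, if_neg hy]
      exact (prodKer_mem T T').2 y y'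
  · have h4 : Q ∘ₘ ρ.fst = ρ.condKernel ∘ₘ ρ.fst := by
      apply Measure.comp_congr
      filter_upwards [hGsub] with p hp
      simp only [Q, Kernel.piecewise_apply, if_pos (show p ∈ G from hp)]
    rw [h4, ← Measure.snd_compProd, hρ]

lemma markov_projection (π : Measure (Pth d N × Pth d N)) [IsProbabilityMeasure π]
    (hs : StepCond T T' π) :
    ∃ Q : ℕ → Kernel (Stt d × Stt d) (Stt d × Stt d), (∀ n, IsMarkovKernel (Q n)) ∧
      Q ∈ admissible T T' N ∧ ∀ i : Fin (N + 1), π.map (evp i) = marg (π.map (evp 0)) Q i := by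
  have key : ∀ n, ∃ Q ∈ PiM (T n) (T' n), ∀ m (hm : m + 1 = n) (hn : n ≤ N),
      Q ∘ₘ (π.map (evp ⟨m, by omega⟩)) = π.map (evp ⟨n, by omega⟩) := by
    intro n
    by_cases hn : 1 ≤ n ∧ n ≤ N
    · obtain ⟨m, rfl⟩ : ∃ m, n = m + 1 := ⟨n - 1, by omega⟩
      obtain ⟨hn1, hn⟩ := hn
      let ρ := π.map (fun ω => (evp (⟨m, by omega⟩ : Fin (N + 1)) ω,
        evp (⟨m + 1, by omega⟩ : Fin (N + 1)) ω))
      have hmeas : Measurable (fun ω => (evp (d := d) (⟨m, by omega⟩ : Fin (N + 1)) ω,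
        evp (d := d) (⟨m + 1, by omega⟩ : Fin (N + 1)) ω)) :=
        (measurable_evp _).prodMk (measurable_evp _)
      have hρ : IsProbabilityMeasure ρ := Measure.isProbabilityMeasure_map hmeas.aemeasurable
      have hfst : ρ.fst = π.map (evp ⟨m, by omega⟩) := by
        rw [Measure.fst, Measure.map_map measurable_fst hmeas]; rfl
      have hsnd : ρ.snd = π.map (evp ⟨m + 1, by omega⟩) := by
        rw [Measure.snd, Measure.map_map measurable_snd hmeas]; rfl
      let g : (Fin (m + 1) → Stt d) × (Fin (m + 1) → Stt d) → Stt d × Stt d :=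
        fun x => (x.1 (Fin.last m), x.2 (Fin.last m))
      have hg : Measurable g := by fun_prop
      obtain ⟨Q, hQ, hQe⟩ := proj_step (T (m + 1)) (T' (m + 1)) ρ
        (by
          rw [hfst, Measure.map_map (by fun_prop) hmeas]
          exact push_step π (prefixPair (m + 1) (by omega)) (measurable_prefixPair _ _) g hg
            (fun ω => ω.1 ⟨m + 1, by omega⟩) (by fun_prop)
            ((T (m + 1)).comap Prod.fst measurable_fst) (hs (m + 1) hn1 hn).1)
        (by
          rw [hfst, Measure.map_map (by fun_prop) hmeas]
          exact push_step π (prefixPair (m + 1) (by omega)) (measurable_prefixPair _ _) g hg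
            (fun ω => ω.2 ⟨m + 1, by omega⟩) (by fun_prop)
            ((T' (m + 1)).comap Prod.snd measurable_snd) (hs (m + 1) hn1 hn).2)
      refine ⟨Q, hQ, fun m' hm' _ => ?_⟩
      obtain rfl : m' = m := by omega
      rw [← hfst, ← hsnd, hQe]
    · exact ⟨prodKer (T n) (T' n), prodKer_mem _ _, fun m hm hn' => absurd ⟨by omega, hn'⟩ hn⟩
  choose Q hQ hQe using key
  refine ⟨Q, fun n => (hQ n).1, fun n _ _ => hQ n, ?_⟩
  rintro ⟨i, hi⟩
  induction i with
  | zero => rfl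
  | succ i ih =>
    have := hQe (i + 1) i rfl (by omega)
    rw [← this, ih (by omega)]
    rfl

/-- replace an admissible family by one which is Markov at all times -/
lemma exists_markov (Q : ℕ → Kernel (Stt d × Stt d) (Stt d × Stt d))
    (hQ : Q ∈ admissible T T' N) :
    ∃ Q' : ℕ → Kernel (Stt d × Stt d) (Stt d × Stt d), (∀ n, IsMarkovKernel (Q' n)) ∧
      Q' ∈ admissible T T' N ∧ ∀ n, 1 ≤ n → n ≤ N → Q n = Q' n := by
  classical
  refine ⟨fun n => if 1 ≤ n ∧ n ≤ N then Q n else prodKer (T n) (T' n), ?_, ?_, ?_⟩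
  · intro n
    dsimp only
    split_ifs with h
    · exact (hQ n h.1 h.2).1
    · infer_instance
  · intro n h1 h2
    dsimp only
    rw [if_pos ⟨h1, h2⟩]
    exact hQ n h1 h2
  · intro n h1 h2
    dsimp only
    rw [if_pos ⟨h1, h2⟩]

lemma measurableSet_step {X : Type*} [MeasurableSpace X] (U : Kernel X (Pth d N × Pth d N))
    [IsMarkovKernel U] : MeasurableSet {x | StepCond T T' (U x)} := by
  have : ∀ {A Z : Type} [MeasurableSpace A] [MeasurableSpace Z] [StandardBorelSpace A]
      [StandardBorelSpace Z] (f : Pth d N × Pth d N → A) (_ : Measurable f)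
      (g : Pth d N × Pth d N → Z) (_ : Measurable g) (κ : Kernel A Z) (_ : IsMarkovKernel κ),
      MeasurableSet {x | (U x).map (fun ω => (f ω, g ω)) = ((U x).map f) ⊗ₘ κ} := by
    intro A Z _ _ _ _ f hf g hg κ hκ
    have : IsMarkovKernel (U.map f) := Kernel.IsMarkovKernel.map _ hf
    have : IsMarkovKernel (U.map (fun ω => (f ω, g ω))) :=
      Kernel.IsMarkovKernel.map _ (hf.prodMk hg)
    convert measurableSet_kernel_eq (U.map (fun ω => (f ω, g ω)))
      ((Kernel.id ×ₖ κ) ∘ₖ (U.map f)) using 1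
    ext x
    have : IsProbabilityMeasure ((U x).map f) := Measure.isProbabilityMeasure_map hf.aemeasurable
    change _ = _ ↔ _ = _
    rw [Kernel.map_apply _ (hf.prodMk hg), Kernel.comp_apply, Kernel.map_apply _ hf,
      Measure.compProd_eq_comp_prod]
  have e : {x | StepCond T T' (U x)} = ⋂ n, ⋂ (_ : 1 ≤ n), ⋂ (hn : n ≤ N),
    ({x | ((U x).map (fun ω => (prefixPair n (by omega) ω, ω.1 ⟨n, by omega⟩))
        = ((U x).map (prefixPair n (by omega)))
            ⊗ₘ ((T n).comap (fun x : (Fin n → Stt d) × (Fin n → Stt d) =>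
                  x.1 ⟨n - 1, by omega⟩) (by fun_prop)))} ∩
    {x | ((U x).map (fun ω => (prefixPair n (by omega) ω, ω.2 ⟨n, by omega⟩))
        = ((U x).map (prefixPair n (by omega)))
            ⊗ₘ ((T' n).comap (fun x : (Fin n → Stt d) × (Fin n → Stt d) =>
                  x.2 ⟨n - 1, by omega⟩) (by fun_prop)))}) := by
    ext x
    simp only [Set.mem_iInter]
    rfl
  rw [e]
  refine MeasurableSet.iInter fun n => MeasurableSet.iInter fun h1 => MeasurableSet.iInter
    fun hn => MeasurableSet.inter ?_ ?_
  · exact this _ (measurable_prefixPair _ _) _ (by fun_prop) _ inferInstance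
  · exact this _ (measurable_prefixPair _ _) _ (by fun_prop) _ inferInstance

/-- the hard inequality -/
lemma exists_coupling_near (c : ℕ → Stt d × Stt d → ℝ≥0∞) (C : ℝ≥0∞) (hC : C ≠ ∞)
    (hc_meas : ∀ n, Measurable (c n)) (hc_bdd : ∀ n p, c n p ≤ C)
    (π₀ : Measure (Stt d × Stt d)) [IsProbabilityMeasure π₀] (ε : ℝ≥0∞) (hε : ε ≠ 0) :
    ∃ π : Measure (Pth d N × Pth d N), IsProbabilityMeasure π ∧ StepCond T T' π ∧
      π.map (evp 0) = π₀ ∧ totalCost c π ≤ ∫⁻ p, Vval c T T' N 0 p ∂π₀ + ε := by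
  obtain ⟨U, hU, hUs⟩ := exists_universal_kernel (Pth d N × Pth d N)
  have hmkU : ∀ p t, Vval c T T' N 0 p < t → ∃ x, (StepCond T T' (U x) ∧
      (U x).map (evp 0) = Measure.dirac p) ∧ totalCost c (U x) < t := by
    intro p t ht
    rw [Vval] at ht
    simp only [iInf_lt_iff] at ht
    obtain ⟨Q, hQ, hJ⟩ := ht
    obtain ⟨Q', hQ'M, hQ', hQQ'⟩ := exists_markov T T' Q hQ
    rw [Jback_congr c Q Q' N hQQ' _ (by omega), Nat.sub_zero] at hJ
    obtain ⟨x, hx⟩ := hUs (mk N (Measure.dirac p) Q') inferInstance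
    refine ⟨x, ?_⟩
    rw [hx]
    refine ⟨⟨mk_step _ Q' T T' hQ', mk_evp _ Q' 0⟩, ?_⟩
    rw [totalCost_of_marg c hc_meas _ (Measure.dirac p) Q' (mk_evp _ Q'),
      lintegral_dirac' _ (measurable_Jback Q' c hc_meas N N)]
    exact hJ
  have hfin : ∀ p, Vval c T T' N 0 p ≠ ∞ := by
    intro p
    let Q : ℕ → Kernel (Stt d × Stt d) (Stt d × Stt d) := fun n => prodKer (T n) (T' n)
    have hQ : Q ∈ admissible T T' N := fun n _ _ => prodKer_mem _ _
    have hJ : ∀ m q, Jback c Q N m q ≤ (m + 1 : ℕ) * C := by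
      intro m
      induction m with
      | zero => intro q; simpa [Jback] using hc_bdd N q
      | succ m ih =>
        intro q
        rw [Jback]
        have h1 : ∫⁻ z, Jback c Q N m z ∂(Q (N - m) q) ≤ (m + 1 : ℕ) * C := by
          refine (lintegral_mono ih).trans ?_
          simp
        calc _ ≤ C + (m + 1 : ℕ) * C := add_le_add (hc_bdd _ _) h1
          _ = _ := by push_cast; ring
    refine ne_top_of_le_ne_top ?_ ((iInf₂_le Q hQ).trans (hJ _ p))
    exact ENNReal.mul_ne_top (ENNReal.natCast_ne_top _) hC
  let H : (ℚ → ℝ) → ℝ≥0∞ := fun x => totalCost c (U x)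
  have hφ : Measurable (fun ω : Pth d N × Pth d N => ∑ i : Fin (N + 1), c i (ω.1 i, ω.2 i)) :=
    Finset.measurable_sum _ fun i _ => (hc_meas i).comp (measurable_evp i)
  have hH : Measurable H := hφ.lintegral_kernel
  let D : Set ((Stt d × Stt d) × (ℚ → ℝ)) :=
    {q | StepCond T T' (U q.2) ∧ (U q.2).map (evp 0) = Measure.dirac q.1}
  have hD : MeasurableSet D := by
    refine MeasurableSet.inter (measurable_snd (measurableSet_step T T' U)) ?_
    have : IsMarkovKernel (U.map (evp 0)) := Kernel.IsMarkovKernel.map _ (measurable_evp 0)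
    have hk := measurableSet_kernel_eq ((U.map (evp 0)).comap
      (Prod.snd : (Stt d × Stt d) × (ℚ → ℝ) → _) measurable_snd)
      (Kernel.deterministic (Prod.fst : (Stt d × Stt d) × (ℚ → ℝ) → _) measurable_fst)
    simp only [Kernel.comap_apply, Kernel.map_apply _ (measurable_evp 0),
      Kernel.deterministic_apply] at hk
    exact hk
  obtain ⟨s, hs, hsae⟩ := exists_near_opt π₀ D hD H hH (Vval c T T' N 0) hfin hmkU ε hε
  let K : Kernel (Stt d × Stt d) (Pth d N × Pth d N) := U.comap s hs
  refine ⟨K ∘ₘ π₀, inferInstance, ?_, ?_, ?_⟩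
  · intro n hn1 hn
    constructor
    · refine bind_step π₀ K _ (measurable_prefixPair _ _) _ (by fun_prop) _ ?_
      filter_upwards [hsae] with p hp
      exact (hp.1.1 n hn1 hn).1
    · refine bind_step π₀ K _ (measurable_prefixPair _ _) _ (by fun_prop) _ ?_
      filter_upwards [hsae] with p hp
      exact (hp.1.1 n hn1 hn).2
  · rw [Measure.map_comp _ _ (measurable_evp 0)]
    have : (K.map (evp 0)) ∘ₘ π₀ = Kernel.id ∘ₘ π₀ := by
      apply Measure.comp_congr
      filter_upwards [hsae] with p hp
      rw [Kernel.map_apply _ (measurable_evp 0), Kernel.id_apply]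
      exact hp.1.2
    rw [this, Measure.id_comp]
  · have h1 : totalCost c (K ∘ₘ π₀) = ∫⁻ p, H (s p) ∂π₀ := by
      unfold totalCost
      rw [Measure.lintegral_bind (Kernel.aemeasurable _) hφ.aemeasurable]
      rfl
    rw [h1]
    calc _ ≤ ∫⁻ p, (Vval c T T' N 0 p + ε) ∂π₀ :=
          lintegral_mono_ae (hsae.mono fun p hp => hp.2)
      _ = _ := by rw [lintegral_add_right _ measurable_const]; simp

end coupl

theorem bicausal_value_representation (d N : ℕ)
    (μ₀ μ₀' : Measure (Stt d)) [IsProbabilityMeasure μ₀] [IsProbabilityMeasure μ₀']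
    (T T' : ℕ → Kernel (Stt d) (Stt d))
    [∀ n, IsMarkovKernel (T n)] [∀ n, IsMarkovKernel (T' n)]
    (μ μ' : Measure (Pth d N))
    (hμ : μ = pathMeasure μ₀ T N) (hμ' : μ' = pathMeasure μ₀' T' N)
    (c : ℕ → Stt d × Stt d → ℝ≥0∞) (C : ℝ≥0∞) (hC : C ≠ ∞)
    (hc_meas : ∀ n, Measurable (c n)) (hc_bdd : ∀ n p, c n p ≤ C) :
    ((⨅ π ∈ {π | IsProbabilityMeasure π ∧ IsBicausal μ μ' T T' π}, totalCost c π)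
        = ⨅ π₀ ∈ {π₀ : Measure (Stt d × Stt d) | IsProbabilityMeasure π₀ ∧
              π₀.map Prod.fst = μ₀ ∧ π₀.map Prod.snd = μ₀'},
            ∫⁻ p, Vval c T T' N 0 p ∂π₀) ∧
    ((⨅ π ∈ {π | IsProbabilityMeasure π ∧ IsBicausal μ μ' T T' π}, totalCost c π)
        = ⨅ π ∈ Mbc N μ₀ μ₀' T T', totalCost c π) := by
  subst hμ hμ'
  -- Markov ≤ bicausal
  have hMA : (⨅ π ∈ Mbc N μ₀ μ₀' T T', totalCost c π) ≤
      ⨅ π ∈ {π | IsProbabilityMeasure π ∧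
        IsBicausal (pathMeasure μ₀ T N) (pathMeasure μ₀' T' N) T T' π}, totalCost c π := by
    refine le_iInf₂ fun π hπ => ?_
    obtain ⟨hp, hb1, hb2, hs⟩ := hπ
    obtain ⟨Q, hQM, hQ, hQe⟩ := markov_projection T T' π hs
    have hp0 : IsProbabilityMeasure (π.map (evp 0)) :=
      Measure.isProbabilityMeasure_map (measurable_evp 0).aemeasurable
    have e : totalCost c π = totalCost c (mk N (π.map (evp 0)) Q) := by
      rw [totalCost_of_marg c hc_meas π _ Q hQe,
        totalCost_of_marg c hc_meas _ _ Q (mk_evp (π.map (evp 0)) Q)]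
    have hz1 : (pathMeasure μ₀ T N).map (fun h => h 0) = μ₀ := pathMeasure_eval μ₀ T N 0
    have hz2 : (pathMeasure μ₀' T' N).map (fun h => h 0) = μ₀' := pathMeasure_eval μ₀' T' N 0
    rw [e]
    refine iInf₂_le _ ⟨π.map (evp 0), Q, hp0, ?_, ?_, hQ, rfl⟩
    · rw [← hz1, ← hb1, Measure.map_map (by fun_prop) (measurable_evp 0),
        Measure.map_map (by fun_prop) (by fun_prop)]
      rfl
    · rw [← hz2, ← hb2, Measure.map_map (by fun_prop) (measurable_evp 0),
        Measure.map_map (by fun_prop) (by fun_prop)]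
      rfl
  -- value ≤ Markov
  have hVM : (⨅ π₀ ∈ {π₀ : Measure (Stt d × Stt d) | IsProbabilityMeasure π₀ ∧
              π₀.map Prod.fst = μ₀ ∧ π₀.map Prod.snd = μ₀'},
            ∫⁻ p, Vval c T T' N 0 p ∂π₀) ≤ ⨅ π ∈ Mbc N μ₀ μ₀' T T', totalCost c π := by
    refine le_iInf₂ fun π hπ => ?_
    obtain ⟨π₀, Q, hp, h1, h2, hQ, rfl⟩ := hπ
    obtain ⟨Q', hQ'M, hQ', hQQ'⟩ := exists_markov T T' Q hQ
    rw [pathMeasure_congr π₀ Q Q' N hQQ']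
    change _ ≤ totalCost c (mk N π₀ Q')
    rw [totalCost_of_marg c hc_meas _ _ Q' (mk_evp π₀ Q')]
    refine (iInf₂_le π₀ ⟨hp, h1, h2⟩).trans (lintegral_mono fun p => ?_)
    exact iInf₂_le Q' hQ'
  -- bicausal ≤ value
  have hAV : (⨅ π ∈ {π | IsProbabilityMeasure π ∧
        IsBicausal (pathMeasure μ₀ T N) (pathMeasure μ₀' T' N) T T' π}, totalCost c π) ≤
      ⨅ π₀ ∈ {π₀ : Measure (Stt d × Stt d) | IsProbabilityMeasure π₀ ∧
              π₀.map Prod.fst = μ₀ ∧ π₀.map Prod.snd = μ₀'},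
            ∫⁻ p, Vval c T T' N 0 p ∂π₀ := by
    refine le_iInf₂ fun π₀ hπ₀ => ?_
    obtain ⟨hp, h1, h2⟩ := hπ₀
    refine ENNReal.le_of_forall_pos_le_add fun ε hε _ => ?_
    obtain ⟨π, hπ, hs, h0, hcost⟩ := exists_coupling_near (N := N) T T' c C hC hc_meas hc_bdd π₀
      (ε : ℝ≥0∞) (by exact_mod_cast hε.ne')
    refine (iInf₂_le π ⟨hπ, ?_⟩).trans hcost
    exact isBicausal_of_step T T' μ₀ μ₀' π hs (by rw [h0, h1]) (by rw [h0, h2])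
  exact ⟨le_antisymm hAV (hVM.trans hMA), le_antisymm (hAV.trans hVM) hMA⟩

end
end

section
/- Average regret bound for KL-regularized policy gradient: under Assumption (B), if 0 < η_K ≤ η_{K−1} ≤ … ≤ η_1 ≤ min{1/L(β), 1/μ(β)}, then for every K ≥ 1 the average regret satisfies Reḡ_K(β) ≤ (Err_1(β)/K) Σ_{k=1}^K ∏_{s=1}^{k−1}(1 − μ(β) η_s) + (L(β) σ²(β) / (2 B K)) Σ_{k=1}^{K−1} η_k² Σ_{t=k}^{K−1} ∏_{s=k+1}^{t}(1 − μ(β) η_s), with the conventions that empty sums vanish and empty products equal 1. -/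
open MeasureTheory

/-- The descent lemma for a function with Lipschitz gradient. -/
lemma aux_descent {E : Type*} [NormedAddCommGroup E] [InnerProductSpace ℝ E] [CompleteSpace E]
    (J : E → ℝ) (gradJ : E → E) (L : ℝ)
    (hgrad : ∀ x, HasGradientAt J (gradJ x) x)
    (hLip : ∀ x y, ‖gradJ x - gradJ y‖ ≤ L * ‖x - y‖) (x v : E) :
    J (x + v) ≤ J x + inner ℝ (gradJ x) v + L / 2 * ‖v‖ ^ 2 := by
  have hf : ∀ t : ℝ, HasDerivAt (fun t : ℝ => J (x + t • v))
      (inner ℝ (gradJ (x + t • v)) v) t := by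
    intro t
    have h1 : HasDerivAt (fun t : ℝ => x + t • v) v t := by
      simpa using ((hasDerivAt_id t).smul_const v).const_add x
    have h2 := (hgrad (x + t • v)).hasFDerivAt.comp_hasDerivAt t h1
    exact h2
  have hB : ∀ t : ℝ, HasDerivAt
      (fun t : ℝ => J x + t * inner ℝ (gradJ x) v + L / 2 * ‖v‖ ^ 2 * t ^ 2)
      (inner ℝ (gradJ x) v + L * ‖v‖ ^ 2 * t) t := by
    intro t
    have h1 := (((hasDerivAt_id t).mul_const (inner ℝ (gradJ x) v)).const_add (J x)).add
      (((hasDerivAt_id t).pow 2).const_mul (L / 2 * ‖v‖ ^ 2))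
    refine HasDerivAt.congr_deriv h1 ?_
    simp
    ring
  have key := image_le_of_deriv_right_le_deriv_boundary (a := 0) (b := 1)
    (fun t _ => (hf t).continuousAt.continuousWithinAt)
    (fun t _ => (hf t).hasDerivWithinAt) (by simp)
    (fun t _ => (hB t).continuousAt.continuousWithinAt)
    (fun t _ => (hB t).hasDerivWithinAt) (by
      intro t ht
      have h1 : inner ℝ (gradJ (x + t • v)) v - inner ℝ (gradJ x) v
          = inner ℝ (gradJ (x + t • v) - gradJ x) v := by rw [inner_sub_left]
      have h2 := real_inner_le_norm (gradJ (x + t • v) - gradJ x) v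
      have h3 := hLip (x + t • v) x
      have h4 : ‖x + t • v - x‖ = t * ‖v‖ := by
        rw [add_sub_cancel_left, norm_smul, Real.norm_of_nonneg ht.1]
      rw [h4] at h3
      nlinarith [mul_le_mul_of_nonneg_right h3 (norm_nonneg v)])
    (show (1 : ℝ) ∈ Set.Icc (0 : ℝ) 1 by simp)
  simpa using key

/-- Unrolling the linear recursion. -/
lemma aux_unroll (e η : ℕ → ℝ) (μ c : ℝ)
    (hc : ∀ k, 1 ≤ k → 0 ≤ 1 - μ * η k)
    (h : ∀ k, 1 ≤ k → e (k + 1) ≤ (1 - μ * η k) * e k + c * η k ^ 2) (n : ℕ) :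
    e (n + 1) ≤ e 1 * ∏ s ∈ Finset.Icc 1 n, (1 - μ * η s)
      + c * ∑ j ∈ Finset.Icc 1 n, η j ^ 2 * ∏ s ∈ Finset.Icc (j + 1) n, (1 - μ * η s) := by
  induction n with
  | zero => simp
  | succ n ih =>
    have h1 := h (n + 1) (by omega)
    have h2 := mul_le_mul_of_nonneg_left ih (hc (n + 1) (by omega))
    refine h1.trans ?_
    rw [Finset.prod_Icc_succ_top (by omega), Finset.sum_Icc_succ_top (by omega)]
    have h3 : ∑ j ∈ Finset.Icc 1 n, η j ^ 2 * ∏ s ∈ Finset.Icc (j + 1) (n + 1), (1 - μ * η s)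
        = (∑ j ∈ Finset.Icc 1 n, η j ^ 2 * ∏ s ∈ Finset.Icc (j + 1) n, (1 - μ * η s))
          * (1 - μ * η (n + 1)) := by
      rw [Finset.sum_mul]
      refine Finset.sum_congr rfl fun j hj => ?_
      rw [Finset.mem_Icc] at hj
      rw [Finset.prod_Icc_succ_top (by omega), mul_assoc]
    rw [h3]
    simp only [Finset.Icc_eq_empty (show ¬ n + 1 + 1 ≤ n + 1 by omega), Finset.prod_empty]
    linarith

/-- Summing up the unrolled recursion. -/
lemma aux_sum (e η : ℕ → ℝ) (μ c : ℝ)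
    (hc : ∀ k, 1 ≤ k → 0 ≤ 1 - μ * η k)
    (h : ∀ k, 1 ≤ k → e (k + 1) ≤ (1 - μ * η k) * e k + c * η k ^ 2) (K : ℕ) (hK : 1 ≤ K) :
    ∑ k ∈ Finset.Icc 1 K, e k ≤
      e 1 * ∑ k ∈ Finset.Icc 1 K, ∏ s ∈ Finset.Icc 1 (k - 1), (1 - μ * η s)
      + c * ∑ k ∈ Finset.Icc 1 (K - 1), (η k) ^ 2
          * ∑ t ∈ Finset.Icc k (K - 1), ∏ s ∈ Finset.Icc (k + 1) t, (1 - μ * η s) := by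
  have hswap : ∑ k ∈ Finset.Icc 1 (K - 1), (η k) ^ 2
          * ∑ t ∈ Finset.Icc k (K - 1), ∏ s ∈ Finset.Icc (k + 1) t, (1 - μ * η s)
      = ∑ k ∈ Finset.Icc 1 K, ∑ j ∈ Finset.Icc 1 (k - 1),
          η j ^ 2 * ∏ s ∈ Finset.Icc (j + 1) (k - 1), (1 - μ * η s) := by
    obtain ⟨n, rfl⟩ : ∃ n, K = n + 1 := ⟨K - 1, by omega⟩
    have hs : ∀ f : ℕ → ℝ, f 0 = 0 →
        ∑ k ∈ Finset.Icc 1 (n + 1), f (k - 1) = ∑ t ∈ Finset.Icc 1 n, f t := by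
      intro f hf
      clear hK
      induction n with
      | zero => simp [hf]
      | succ n ih =>
        rw [Finset.sum_Icc_succ_top (by omega), ih, Finset.sum_Icc_succ_top (by omega)]
        simp
    rw [hs (fun t => ∑ j ∈ Finset.Icc 1 t,
          η j ^ 2 * ∏ s ∈ Finset.Icc (j + 1) t, (1 - μ * η s)) (by simp)]
    simp only [Finset.mul_sum, Nat.add_sub_cancel]
    apply Finset.sum_comm'
    intro x y
    simp only [Finset.mem_Icc]
    omega
  rw [hswap, Finset.mul_sum, Finset.mul_sum, ← Finset.sum_add_distrib]
  refine Finset.sum_le_sum fun k hk => ?_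
  rw [Finset.mem_Icc] at hk
  have := aux_unroll e η μ c hc h (k - 1)
  rwa [Nat.sub_add_cancel hk.1] at this

/-!
Average regret bound for the KL-regularized policy gradient method: under Assumption (B)
(`L(β)`-smoothness, Polyak–Łojasiewicz condition, unbiased mini-batch stochastic gradients
with conditional second moment bounded by `σ(β)²/B`, `σ(β) = σ_val + β σ_KL`), if the step
sizes satisfy `0 < η_K ≤ … ≤ η_1 ≤ min (1/L(β)) (1/μ(β))`, then for every `K ≥ 1` the
average regret `(1/K) Σ_{k=1}^K E[J_β(θ_k) − J_β*]` is bounded by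
`(Err_1/K) Σ_{k=1}^K ∏_{s=1}^{k-1} (1 − μ(β) η_s)
  + (L(β) σ(β)² / (2BK)) Σ_{k=1}^{K-1} η_k² Σ_{t=k}^{K-1} ∏_{s=k+1}^t (1 − μ(β) η_s)`,
with empty sums equal to `0` and empty products equal to `1`.
-/
theorem average_regret_bound_kl_policy_gradient
    {Ω : Type*} {m0 : MeasurableSpace Ω} (P : Measure Ω) [IsProbabilityMeasure P]
    {E : Type*} [NormedAddCommGroup E] [InnerProductSpace ℝ E] [CompleteSpace E]
    (J : E → ℝ) (gradJ : E → E) (Jstar : ℝ)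
    (L μβ σval σKL β : ℝ) (B : ℕ)
    (hL : 0 < L) (hμβ : 0 < μβ) (hB : 1 ≤ B) (hβ : 0 ≤ β)
    (hσval : 0 ≤ σval) (hσKL : 0 ≤ σKL)
    -- Assumption (B)(i): smoothness
    (hgrad : ∀ x, HasGradientAt J (gradJ x) x)
    (hLip : ∀ x y, ‖gradJ x - gradJ y‖ ≤ L * ‖x - y‖)
    -- `J_β* = inf J_β`
    (hbdd : BddBelow (Set.range J)) (hJstar : Jstar = ⨅ x, J x)
    -- Assumption (B)(ii): Polyak–Łojasiewicz condition
    (hPL : ∀ x, μβ * (J x - Jstar) ≤ (1 / 2) * ‖gradJ x‖ ^ 2)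
    -- the stochastic gradient iterates
    (ℱ : Filtration ℕ m0) (θ g : ℕ → Ω → E) (η : ℕ → ℝ)
    (hadapt : ∀ k, StronglyMeasurable[ℱ k] (θ k))
    (hupdate : ∀ k ω, θ (k + 1) ω = θ k ω - η k • g k ω)
    -- unbiasedness of the mini-batch estimator
    (hintg : ∀ k, Integrable (g k) P)
    (hunbiased : ∀ k, P[g k|ℱ k] =ᵐ[P] fun ω => gradJ (θ k ω))
    -- Assumption (B)(iii): conditional second-moment bound `σ(β)²/B`
    (hnoise_int : ∀ k, Integrable (fun ω => ‖g k ω - gradJ (θ k ω)‖ ^ 2) P)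
    (hnoise : ∀ k, P[(fun ω => ‖g k ω - gradJ (θ k ω)‖ ^ 2)|ℱ k]
        ≤ᵐ[P] fun _ => (σval + β * σKL) ^ 2 / B)
    (hintJ : ∀ k, Integrable (fun ω => J (θ k ω)) P)
    -- step sizes `0 < η_K ≤ η_{K-1} ≤ … ≤ η_1 ≤ min (1/L(β)) (1/μ(β))`
    (hηpos : ∀ k, 1 ≤ k → 0 < η k)
    (hηmono : ∀ k, 1 ≤ k → η (k + 1) ≤ η k)
    (hη1 : η 1 ≤ min (1 / L) (1 / μβ))
    (K : ℕ) (hK : 1 ≤ K) :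
    (1 / K : ℝ) * ∑ k ∈ Finset.Icc 1 K, (∫ ω, (J (θ k ω) - Jstar) ∂P)
      ≤ (∫ ω, (J (θ 1 ω) - Jstar) ∂P) / K
            * ∑ k ∈ Finset.Icc 1 K, ∏ s ∈ Finset.Icc 1 (k - 1), (1 - μβ * η s)
        + (L * (σval + β * σKL) ^ 2) / (2 * B * K)
            * ∑ k ∈ Finset.Icc 1 (K - 1), (η k) ^ 2
                * ∑ t ∈ Finset.Icc k (K - 1), ∏ s ∈ Finset.Icc (k + 1) t, (1 - μβ * η s) := by
  have hJle : ∀ x, Jstar ≤ J x := fun x => hJstar ▸ ciInf_le hbdd x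
  have hdesc := aux_descent J gradJ L hgrad hLip
  have hηle : ∀ k, 1 ≤ k → η k ≤ η 1 := by
    intro k hk
    induction k, hk using Nat.le_induction with
    | base => exact le_rfl
    | succ k hk ih => exact (hηmono k hk).trans ih
  have hηL : ∀ k, 1 ≤ k → L * η k ≤ 1 := by
    intro k hk
    have := (hηle k hk).trans (hη1.trans (min_le_left _ _))
    rw [le_div_iff₀ hL] at this
    linarith
  have hημ : ∀ k, 1 ≤ k → 0 ≤ 1 - μβ * η k := by
    intro k hk
    have := (hηle k hk).trans (hη1.trans (min_le_right _ _))
    rw [le_div_iff₀ hμβ] at this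
    linarith
  have hgsq : ∀ x, ‖gradJ x‖ ^ 2 ≤ 2 * L * (J x - Jstar) := by
    intro x
    have h1 := hdesc x (-(1 / L) • gradJ x)
    have h2 := hJle (x + -(1 / L) • gradJ x)
    rw [real_inner_smul_right, real_inner_self_eq_norm_sq, norm_smul, mul_pow, norm_neg,
      Real.norm_of_nonneg (by positivity)] at h1
    have h3 : L / 2 * ((1 / L) ^ 2 * ‖gradJ x‖ ^ 2) = 1 / L * ‖gradJ x‖ ^ 2 / 2 := by
      field_simp
    have h4 : 1 / L * ‖gradJ x‖ ^ 2 ≤ 2 * (J x - Jstar) := by linarith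
    have h5 := mul_le_mul_of_nonneg_left h4 hL.le
    have h6 : L * (1 / L * ‖gradJ x‖ ^ 2) = ‖gradJ x‖ ^ 2 := by field_simp
    linarith
  have hcont : Continuous gradJ := by
    refine (LipschitzWith.of_dist_le_mul (K := ⟨L, hL.le⟩) fun x y => ?_).continuous
    rw [dist_eq_norm, dist_eq_norm]
    exact hLip x y
  have hGm : ∀ k, StronglyMeasurable[ℱ k] (fun ω => gradJ (θ k ω)) := fun k =>
    hcont.comp_stronglyMeasurable (hadapt k)
  have hGae : ∀ k, AEStronglyMeasurable (fun ω => gradJ (θ k ω)) P := fun k =>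
    ((hGm k).mono (ℱ.le k)).aestronglyMeasurable
  have hGint : ∀ k, Integrable (fun ω => ‖gradJ (θ k ω)‖ ^ 2) P := by
    intro k
    refine Integrable.mono' (((hintJ k).sub (integrable_const Jstar)).const_mul (2 * L))
      ((hGae k).norm.pow 2) (Filter.Eventually.of_forall fun ω => ?_)
    rw [Real.norm_of_nonneg (by positivity)]
    exact hgsq _
  have hIint : ∀ k, Integrable (fun ω => inner ℝ (gradJ (θ k ω)) (g k ω)) P := by
    intro k
    refine Integrable.mono' (((hGint k).const_mul 2).add (hnoise_int k))
      ((hGae k).inner (hintg k).1) (Filter.Eventually.of_forall fun ω => ?_)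
    have h1 := norm_inner_le_norm (𝕜 := ℝ) (gradJ (θ k ω)) (g k ω)
    have h2 := norm_add_le (g k ω - gradJ (θ k ω)) (gradJ (θ k ω))
    rw [sub_add_cancel] at h2
    have h3 := mul_le_mul_of_nonneg_left h2 (norm_nonneg (gradJ (θ k ω)))
    simp only [Pi.add_apply]
    nlinarith [sq_nonneg (‖g k ω - gradJ (θ k ω)‖ - ‖gradJ (θ k ω)‖),
      sq_nonneg (‖g k ω - gradJ (θ k ω)‖)]
  have hIeq : ∀ k, ∫ ω, inner ℝ (gradJ (θ k ω)) (g k ω) ∂P = ∫ ω, ‖gradJ (θ k ω)‖ ^ 2 ∂P := by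
    intro k
    have h1 : P[fun ω => inner ℝ (gradJ (θ k ω)) (g k ω) | ℱ k] =ᵐ[P]
        fun ω => inner ℝ (gradJ (θ k ω)) (P[g k | ℱ k] ω) :=
      condExp_bilin_of_stronglyMeasurable_left (μ := P) (innerSL ℝ) (hGm k)
        (hIint k) (hintg k)
    rw [← integral_condExp (ℱ.le k)]
    refine integral_congr_ae ?_
    filter_upwards [h1, hunbiased k] with ω h2 h3
    rw [h2, h3, real_inner_self_eq_norm_sq]
  have hV : ∀ k, ∫ ω, ‖g k ω - gradJ (θ k ω)‖ ^ 2 ∂P ≤ (σval + β * σKL) ^ 2 / B := by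
    intro k
    rw [← integral_condExp (ℱ.le k)]
    refine (integral_mono_ae integrable_condExp (integrable_const _) (hnoise k)).trans ?_
    simp
  have hstep : ∀ k, 1 ≤ k → ∫ ω, (J (θ (k + 1) ω) - Jstar) ∂P
      ≤ (1 - μβ * η k) * ∫ ω, (J (θ k ω) - Jstar) ∂P
        + (L * (σval + β * σKL) ^ 2 / (2 * B)) * η k ^ 2 := by
    intro k hk
    have hη := hηpos k hk
    have hJk : Integrable (fun ω => J (θ k ω) - Jstar) P := (hintJ k).sub (integrable_const _)
    have hJk1 : Integrable (fun ω => J (θ (k + 1) ω) - Jstar) P :=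
      (hintJ (k + 1)).sub (integrable_const _)
    have hI := (hIint k).const_mul (-η k + L * η k ^ 2)
    have hG := (hGint k).const_mul (-(L * η k ^ 2 / 2))
    have hN := (hnoise_int k).const_mul (L * η k ^ 2 / 2)
    have hpt : ∀ ω, J (θ (k + 1) ω) - Jstar ≤ (J (θ k ω) - Jstar)
        + (-η k + L * η k ^ 2) * inner ℝ (gradJ (θ k ω)) (g k ω)
        + -(L * η k ^ 2 / 2) * ‖gradJ (θ k ω)‖ ^ 2
        + L * η k ^ 2 / 2 * ‖g k ω - gradJ (θ k ω)‖ ^ 2 := by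
      intro ω
      have h1 := hdesc (θ k ω) (-(η k • g k ω))
      rw [← sub_eq_add_neg, ← hupdate, inner_neg_right, real_inner_smul_right, norm_neg,
        norm_smul, mul_pow, Real.norm_of_nonneg hη.le] at h1
      rw [norm_sub_sq_real, real_inner_comm (gradJ (θ k ω)) (g k ω)]
      linarith
    have h1 := integral_mono hJk1 (((hJk.add hI).add hG).add hN) hpt
    have h2 : ∫ ω, ((J (θ k ω) - Jstar)
        + (-η k + L * η k ^ 2) * inner ℝ (gradJ (θ k ω)) (g k ω)
        + -(L * η k ^ 2 / 2) * ‖gradJ (θ k ω)‖ ^ 2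
        + L * η k ^ 2 / 2 * ‖g k ω - gradJ (θ k ω)‖ ^ 2) ∂P
        = ∫ ω, (J (θ k ω) - Jstar) ∂P
          + (-η k + L * η k ^ 2) * ∫ ω, ‖gradJ (θ k ω)‖ ^ 2 ∂P
          + -(L * η k ^ 2 / 2) * ∫ ω, ‖gradJ (θ k ω)‖ ^ 2 ∂P
          + L * η k ^ 2 / 2 * ∫ ω, ‖g k ω - gradJ (θ k ω)‖ ^ 2 ∂P := by
      have e1 := integral_add ((hJk.add hI).add hG) hN
      have e2 := integral_add (hJk.add hI) hG
      have e3 := integral_add hJk hI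
      simp only [Pi.add_apply] at e1 e2 e3
      rw [e1, e2, e3, integral_const_mul, integral_const_mul, integral_const_mul, hIeq]
    have h3 : μβ * ∫ ω, (J (θ k ω) - Jstar) ∂P ≤ (1 / 2) * ∫ ω, ‖gradJ (θ k ω)‖ ^ 2 ∂P := by
      rw [← integral_const_mul, ← integral_const_mul]
      exact integral_mono (hJk.const_mul _) ((hGint k).const_mul _) fun ω => hPL _
    have h4 : 0 ≤ ∫ ω, ‖gradJ (θ k ω)‖ ^ 2 ∂P := integral_nonneg fun ω => by positivity
    have h5 := mul_le_mul_of_nonneg_left (hV k) (show 0 ≤ L * η k ^ 2 / 2 by positivity)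
    have h6 : L * η k ^ 2 / 2 * ((σval + β * σKL) ^ 2 / B)
        = (L * (σval + β * σKL) ^ 2 / (2 * B)) * η k ^ 2 := by
      rw [div_mul_div_comm, div_mul_eq_mul_div]
      ring
    have h7 := mul_le_mul_of_nonneg_left h3 hη.le
    have h8 : 0 ≤ (η k * (1 - L * η k)) * ∫ ω, ‖gradJ (θ k ω)‖ ^ 2 ∂P :=
      mul_nonneg (mul_nonneg hη.le (by linarith [hηL k hk])) h4
    have h9 := h1.trans_eq h2
    rw [h6] at h5
    nlinarith
  have hfin := aux_sum (fun k => ∫ ω, (J (θ k ω) - Jstar) ∂P) η μβ _ hημ hstep K hK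
  have hK0 : (0 : ℝ) < K := by exact_mod_cast hK
  refine (mul_le_mul_of_nonneg_left hfin (by positivity)).trans_eq ?_
  have hc : L * (σval + β * σKL) ^ 2 / (2 * B * K)
      = 1 / K * (L * (σval + β * σKL) ^ 2 / (2 * B)) := by
    rw [div_mul_div_comm, one_mul, mul_comm (K : ℝ)]
  rw [hc]
  ring
end
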